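/- Let n ≥ 2, let x₁, …, x_m be distinct points of ℂⁿ, and let u ∈ ℂⁿ be a nonzero vector. Every neighbourhood of the identity in Aut_{ω₀}(ℂⁿ) contains an automorphism h such that: (1) h(x_j) = x_j for j = 1, …, m; (2) Dh(x_j) = id for j = 2, …, m; and (3) Dh(x₁)u = αu for some real number α > 1. -/

import Mathlib

open Topology Filter Metric Set Function

noncomputable section

/-- ℂⁿ with the Euclidean norm. -/
abbrev En (n : ℕ) : Type := EuclideanSpace ℂ (Fin n)

/-- A holomorphic automorphism of ℂⁿ: a bijection that is holomorphic with holomorphic inverse. -/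
def IsHoloAut {n : ℕ} (f : En n → En n) : Prop :=
  Differentiable ℂ f ∧ ∃ g : En n → En n, Differentiable ℂ g ∧
    Function.LeftInverse g f ∧ Function.RightInverse g f

/-- Volume-preserving with respect to ω₀ = dz₁∧⋯∧dzₙ: det Df(z) = 1 for all z. -/
def IsVolPres {n : ℕ} (f : En n → En n) : Prop :=
  ∀ z : En n, (fderiv ℂ f z).det = 1

/-- Aut(ℂⁿ) as a subset of C(ℂⁿ, ℂⁿ) with the compact-open topology. -/
def AutCN (n : ℕ) : Set C(En n, En n) := {f | IsHoloAut ⇑f}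

/-- Aut_{ω₀}(ℂⁿ) as a subset of C(ℂⁿ, ℂⁿ) with the compact-open topology. -/
def AutOmega (n : ℕ) : Set C(En n, En n) := {f | IsHoloAut ⇑f ∧ IsVolPres ⇑f}

/-- A continuous self-map is chaotic if it has a dense forward orbit and its set of
periodic points is dense. -/
def Chaotic {α : Type*} [TopologicalSpace α] (f : α → α) : Prop :=
  (∃ x : α, Dense (Set.range fun k : ℕ => f^[k] x)) ∧
  Dense {x : α | ∃ k : ℕ, 0 < k ∧ f^[k] x = x}

/-- Expelling: the set of points with unbounded forward orbit is dense. -/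
def Expelling {n : ℕ} (f : En n → En n) : Prop :=
  Dense {x : En n | ¬ Bornology.IsBounded (Set.range fun k : ℕ => f^[k] x)}

/-- p is a hyperbolic fixed point of f: f(p) = p and no eigenvalue of Df(p) has modulus 1. -/
def HypFixedPt {n : ℕ} (f : En n → En n) (p : En n) : Prop :=
  f p = p ∧ ∀ μ : ℂ, Module.End.HasEigenvalue
    ((fderiv ℂ f p : En n →ₗ[ℂ] En n) : Module.End ℂ (En n)) μ → ‖μ‖ ≠ 1

/-- The stable manifold of a fixed point p of f: points whose forward orbit tends to p. -/
def StableSet {n : ℕ} (f : En n → En n) (p : En n) : Set (En n) :=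
  {x : En n | Tendsto (fun k : ℕ => f^[k] x) atTop (𝓝 p)}

/-- The identity is a volume-preserving holomorphic automorphism of ℂⁿ. -/
theorem idMemAutOmega (n : ℕ) : ContinuousMap.id (En n) ∈ AutOmega n := by
  refine ⟨⟨differentiable_id, id, differentiable_id, fun x => rfl, fun x => rfl⟩, ?_⟩
  intro z
  have h : fderiv ℂ (⇑(ContinuousMap.id (En n))) z = ContinuousLinearMap.id ℂ (En n) :=
    fderiv_id
  simp [ContinuousLinearMap.det, h]

open Polynomial in
theorem exPoly (S : Finset ℂ) (a : ℂ) (ha : a ∉ S) :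
    ∃ f : Polynomial ℂ, f.eval a = 0 ∧ f.derivative.eval a = 1 ∧
      ∀ s ∈ S, f.eval s = 0 ∧ f.derivative.eval s = 0 := by
  classical
  set g : Polynomial ℂ := ∏ s ∈ S, (X - C s) ^ 2 with hg
  have hga : g.eval a ≠ 0 := by
    rw [hg, eval_prod, Finset.prod_ne_zero_iff]
    intro s hs
    simp only [eval_pow, eval_sub, eval_X, eval_C]
    refine pow_ne_zero _ (sub_ne_zero.2 ?_)
    rintro rfl
    exact ha hs
  refine ⟨C ((g.eval a)⁻¹) * ((X - C a) * g), by simp, by simp [hga], ?_⟩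
  intro s hs
  have h : g = (X - C s) ^ 2 * ∏ s ∈ S.erase s, (X - C s) ^ 2 := by
    rw [hg, Finset.mul_prod_erase S (fun s => (X - C s) ^ 2) hs]
  generalize g.eval a = c
  rw [h]
  constructor <;> simp [derivative_mul, derivative_pow]

theorem exFun {n : ℕ} (S : Finset (En n)) (hS : ∀ y ∈ S, y ≠ 0) :
    ∃ l : En n →L[ℂ] ℂ, ∀ y ∈ S, l y ≠ 0 := by
  obtain ⟨f, hf⟩ := Module.exists_dual_forall_apply_ne_zero (K := ℂ) (fun y : S => (y : En n))
    (fun y => hS y y.2)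
  exact ⟨LinearMap.toContinuousLinearMap f, fun y hy => hf ⟨y, hy⟩⟩

def shear {n : ℕ} (f : Polynomial ℂ) (l : En n →L[ℂ] ℂ) (v : En n) (t : ℂ) (z : En n) : En n :=
  z + (t * f.eval (l z)) • v

theorem shear_fd {n : ℕ} (f : Polynomial ℂ) (l : En n →L[ℂ] ℂ) (v : En n) (t : ℂ) (z : En n) :
    HasFDerivAt (shear f l v t)
      (ContinuousLinearMap.id ℂ (En n) + ((t * f.derivative.eval (l z)) • l).smulRight v) z := by
  unfold shear
  have h1 : HasFDerivAt (fun z => f.eval (l z)) (f.derivative.eval (l z) • l) z :=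
    (f.hasDerivAt (l z)).comp_hasFDerivAt z l.hasFDerivAt
  have h2 := (hasFDerivAt_id (𝕜 := ℂ) z).add ((h1.const_mul t).smul_const v)
  rw [smul_smul] at h2
  exact h2

theorem shear_diff {n : ℕ} (f : Polynomial ℂ) (l : En n →L[ℂ] ℂ) (v : En n) (t : ℂ) :
    Differentiable ℂ (shear f l v t) := fun z => (shear_fd f l v t z).differentiableAt

theorem shear_inv {n : ℕ} (f : Polynomial ℂ) (l : En n →L[ℂ] ℂ) (v : En n) (hv : l v = 0)
    (t : ℂ) (z : En n) : shear f l v t (shear f l v (-t) z) = z := by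
  simp [shear, hv]

theorem shear_det {n : ℕ} (f : Polynomial ℂ) (l : En n →L[ℂ] ℂ) (v : En n) (hv : l v = 0)
    (t : ℂ) (z : En n) : (fderiv ℂ (shear f l v t) z).det = 1 := by
  rw [(shear_fd f l v t z).fderiv]
  set k := t * f.derivative.eval (l z)
  have h : ((ContinuousLinearMap.id ℂ (En n) + (k • l).smulRight v : En n →L[ℂ] En n) :
      En n →ₗ[ℂ] En n) = LinearMap.transvection ((k • l : En n →L[ℂ] ℂ) : En n →ₗ[ℂ] ℂ) v := by
    ext y
    simp [LinearMap.transvection]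
  rw [ContinuousLinearMap.det, h, LinearMap.transvection.det]
  simp [hv]

theorem comp_mem {n : ℕ} (f g : Polynomial ℂ) (l k : En n →L[ℂ] ℂ) (v w : En n) (hv : l v = 0)
    (hw : k w = 0) (t s : ℂ) :
    IsHoloAut (fun z => shear g k w s (shear f l v t z)) ∧
    IsVolPres (fun z => shear g k w s (shear f l v t z)) := by
  refine ⟨⟨(shear_diff g k w s).comp (shear_diff f l v t),
    fun z => shear f l v (-t) (shear g k w (-s) z),
    (shear_diff f l v (-t)).comp (shear_diff g k w (-s)), ?_, ?_⟩, ?_⟩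
  · intro z
    have h1 := shear_inv g k w hw (-s)
    have h2 := shear_inv f l v hv (-t)
    simp only [neg_neg] at h1 h2
    simp only [h1, h2]
  · intro z
    simp only [shear_inv f l v hv, shear_inv g k w hw]
  · intro z
    have h := fderiv_comp z (shear_diff g k w s (shear f l v t z)) (shear_diff f l v t z)
    have h' : fderiv ℂ (fun z => shear g k w s (shear f l v t z)) z = _ := h
    rw [h', ContinuousLinearMap.det, ContinuousLinearMap.toLinearMap_comp, LinearMap.det_comp]
    have e1 := shear_det g k w hw s (shear f l v t z)
    have e2 := shear_det f l v hv t z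
    rw [ContinuousLinearMap.det] at e1 e2
    rw [e1, e2, one_mul]


/-- For n ≥ 2, distinct points x₁, …, x_m of ℂⁿ and a nonzero vector u, every
neighbourhood of the identity in Aut_{ω₀}(ℂⁿ) contains an automorphism h fixing each x_j,
with Dh(x_j) = id for j ≥ 2, and Dh(x₁)u = αu for some real α > 1. -/
theorem stmt_10 (n m : ℕ) (hn : 2 ≤ n) (hm : 0 < m)
    (x : Fin m → En n) (hx : Function.Injective x)
    (u : En n) (hu : u ≠ 0)
    (U : Set ↥(AutOmega n))
    (hU : U ∈ 𝓝 (⟨ContinuousMap.id (En n), idMemAutOmega n⟩ : ↥(AutOmega n))) :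
    ∃ h ∈ U, (∀ j : Fin m, h.1 (x j) = x j) ∧
      (∀ j : Fin m, j ≠ ⟨0, hm⟩ →
        fderiv ℂ (⇑h.1) (x j) = ContinuousLinearMap.id ℂ (En n)) ∧
      (∃ α : ℝ, 1 < α ∧ fderiv ℂ (⇑h.1) (x ⟨0, hm⟩) u = (α : ℂ) • u) := by
  classical
  set i0 : Fin m := ⟨0, hm⟩ with hi0
  set Y : Finset (En n) := insert u ((Finset.univ.erase i0).image fun j => x j - x i0) with hY
  have hY0 : ∀ y ∈ Y, y ≠ 0 := by
    intro y hy
    rw [hY, Finset.mem_insert, Finset.mem_image] at hy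
    rcases hy with rfl | ⟨j, hj, rfl⟩
    · exact hu
    · exact sub_ne_zero.2 fun e => (Finset.mem_erase.1 hj).1 (hx e)
  have hYu : u ∈ Y := Finset.mem_insert_self _ _
  have hYx : ∀ j, j ≠ i0 → x j - x i0 ∈ Y := fun j hj =>
    Finset.mem_insert_of_mem (Finset.mem_image.2 ⟨j, by simp [hj], rfl⟩)
  obtain ⟨l, hl⟩ := exFun Y hY0
  obtain ⟨v, hv0, hlv⟩ : ∃ v : En n, v ≠ 0 ∧ l v = 0 := by
    have h1 : LinearMap.ker (l : En n →ₗ[ℂ] ℂ) ≠ ⊥ := by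
      intro h
      have := LinearMap.finrank_le_finrank_of_injective (LinearMap.ker_eq_bot.1 h)
      simp at this
      omega
    obtain ⟨v, hv, hv0⟩ := Submodule.exists_mem_ne_zero_of_ne_bot h1
    exact ⟨v, hv0, hv⟩
  obtain ⟨k, hk⟩ := exFun (insert v Y) (by
    intro y hy
    rcases Finset.mem_insert.1 hy with rfl | hy
    · exact hv0
    · exact hY0 y hy)
  have hkv : k v ≠ 0 := hk v (Finset.mem_insert_self _ _)
  have hkY : ∀ y ∈ Y, k y ≠ 0 := fun y hy => hk y (Finset.mem_insert_of_mem hy)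
  -- normalised data
  obtain ⟨l, hlu, hlv, hl⟩ : ∃ l' : En n →L[ℂ] ℂ, l' u = 1 ∧ l' v = 0 ∧ ∀ y ∈ Y, l' y ≠ 0 := by
    refine ⟨(l u)⁻¹ • l, by simp [hl u hYu], by simp [hlv], fun y hy => ?_⟩
    simp [hl u hYu, hl y hy]
  obtain ⟨k, hku, hkv, hk⟩ : ∃ k' : En n →L[ℂ] ℂ, k' u = 1 ∧ k' v ≠ 0 ∧ ∀ y ∈ Y, k' y ≠ 0 := by
    refine ⟨(k u)⁻¹ • k, by simp [hkY u hYu], by simp [hkv, hkY u hYu], fun y hy => ?_⟩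
    simp [hkY u hYu, hkY y hy]
  obtain ⟨v, hlv, hkv⟩ : ∃ v : En n, l v = 0 ∧ k v = 1 :=
    ⟨(k v)⁻¹ • v, by simp [hlv], by simp [hkv]⟩
  have hkw : k (u - v) = 0 := by simp [hku, hkv]
  have poly : ∀ l : En n →L[ℂ] ℂ, (∀ y ∈ Y, l y ≠ 0) → ∃ f : Polynomial ℂ,
      f.eval (l (x i0)) = 0 ∧ f.derivative.eval (l (x i0)) = 1 ∧
      ∀ j, j ≠ i0 → f.eval (l (x j)) = 0 ∧ f.derivative.eval (l (x j)) = 0 := by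
    intro l hl
    obtain ⟨f, h1, h2, h3⟩ := exPoly ((Finset.univ.erase i0).image fun j => l (x j)) (l (x i0)) (by
      intro h
      obtain ⟨j, hj, e⟩ := Finset.mem_image.1 h
      apply hl _ (hYx j (Finset.mem_erase.1 hj).1)
      rw [map_sub, e, sub_self])
    exact ⟨f, h1, h2, fun j hj => h3 _ (Finset.mem_image.2 ⟨j, by simp [hj], rfl⟩)⟩
  obtain ⟨f, f1, f2, f3⟩ := poly l hl
  obtain ⟨g, g1, g2, g3⟩ := poly k hk
  let H : ℝ → En n → En n := fun s z =>
    shear g k (u - v) (1 - Complex.exp (-s)) (shear f l v (Complex.exp s - 1) z)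
  have Hc : Continuous (Function.uncurry H) := by
    simp only [H, shear, Function.uncurry_def]
    fun_prop
  let F : ℝ → AutOmega n := fun s => ⟨⟨H s, Hc.comp (by fun_prop : Continuous fun z => (s, z))⟩,
    comp_mem f g l k v (u - v) hlv hkw _ _⟩
  have Fc : Continuous F :=
    Continuous.subtype_mk (ContinuousMap.continuous_of_continuous_uncurry _ Hc) _
  have F0 : F 0 = ⟨ContinuousMap.id (En n), idMemAutOmega n⟩ := by
    apply Subtype.ext
    ext1 z
    simp [F, H, shear]
  have hmem : ∀ᶠ s in 𝓝[>] (0 : ℝ), F s ∈ U := by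
    apply nhdsWithin_le_nhds
    apply Fc.continuousAt
    rw [F0]
    exact hU
  obtain ⟨s, hs, hs0⟩ := (hmem.and self_mem_nhdsWithin).exists
  have fix1 : ∀ j t, shear f l v t (x j) = x j := by
    intro j t
    have : f.eval (l (x j)) = 0 := by
      by_cases hj : j = i0
      · rw [hj, f1]
      · exact (f3 j hj).1
    simp [shear, this]
  have fix2 : ∀ j t, shear g k (u - v) t (x j) = x j := by
    intro j t
    have : g.eval (k (x j)) = 0 := by
      by_cases hj : j = i0
      · rw [hj, g1]
      · exact (g3 j hj).1
    simp [shear, this]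
  have hD : ∀ j, HasFDerivAt (H s) ((ContinuousLinearMap.id ℂ (En n) +
      (((1 - Complex.exp (-s)) * g.derivative.eval (k (x j))) • k).smulRight (u - v)).comp
      (ContinuousLinearMap.id ℂ (En n) +
      (((Complex.exp s - 1) * f.derivative.eval (l (x j))) • l).smulRight v)) (x j) := by
    intro j
    have hf := shear_fd f l v (Complex.exp s - 1) (x j)
    have hg := shear_fd g k (u - v) (1 - Complex.exp (-s))
      (shear f l v (Complex.exp s - 1) (x j))
    have hc := hg.comp (x j) hf
    rw [fix1] at hc
    exact hc
  refine ⟨F s, hs, ?_, ?_, Real.exp s, Real.one_lt_exp_iff.2 hs0, ?_⟩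
  · intro j
    change H s (x j) = x j
    simp only [H, fix1, fix2]
  · intro j hj
    change fderiv ℂ (H s) (x j) = _
    rw [(hD j).fderiv, (f3 j hj).2, (g3 j hj).2]
    ext z
    simp
  · change fderiv ℂ (H s) (x i0) u = _
    rw [(hD i0).fderiv, f2, g2]
    have e : Complex.exp (-s) * Complex.exp s = 1 := by rw [← Complex.exp_add]; simp
    simp only [ContinuousLinearMap.comp_apply, ContinuousLinearMap.add_apply,
      ContinuousLinearMap.smulRight_apply, ContinuousLinearMap.smul_apply, map_add, map_smul,
      ContinuousLinearMap.id_apply, hlu, hku, hkv, smul_eq_mul, mul_one, Complex.ofReal_exp]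
    have e2 : (1 - Complex.exp (-s)) * (1 + (Complex.exp s - 1)) = Complex.exp s - 1 := by
      linear_combination -e
    linear_combination (norm := module) e2 • (u - v)
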